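/- Let P(λ) be an m×n matrix polynomial of grade k with m ≤ n, and let L(λ) ∈ 𝕃₂(P) with nonzero left ansatz vector w ∈ F^k have full Z-rank. Let r = nrank P(λ), c = (k−1)(n−m), and 𝓛_w(x(λ)) = (w^T⊗I_n)x(λ) for x(λ) ∈ N_r(L). If β = {x₁(λ), …, x_{n−r}(λ), u_{n−r+1}, …, u_{n−r+c}} is a minimal basis of N_r(L) in which {u_{n−r+1}, …, u_{n−r+c}} ⊂ F^{kn} is a basis of the kernel of 𝓛_w, then {𝓛_w(x₁(λ)), …, 𝓛_w(x_{n−r}(λ))} is a minimal basis of N_r(P). Moreover, if δ₁ ≥ δ₂ ≥ … ≥ δ_{n−r} ≥ 0 = 0 = … = 0 (with c trailing zeros) are the right minimal indices of L(λ), then δ₁ ≥ δ₂ ≥ … ≥ δ_{n−r} are the right minimal indices of P(λ). -/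

import Mathlib

noncomputable section

open Polynomial Matrix

namespace GLin

variable {F : Type*} [RCLike F]

/-! ### Matrix polynomials and pencils -/

/-- The matrix polynomial `P(λ) = ∑_{i=0}^k λ^i A_i` determined by its
coefficient matrices `A_0, …, A_k` (grade `k`). -/
def matPoly {k m n : ℕ} (A : Fin (k + 1) → Matrix (Fin m) (Fin n) F) :
    Matrix (Fin m) (Fin n) F[X] :=
  Matrix.of fun r c => ∑ i : Fin (k + 1), Polynomial.C (A i r c) * Polynomial.X ^ (i : ℕ)

/-- The matrix pencil `L(λ) = λ X + Y`. -/
def pencil {ρ γ : Type*} (Xc Yc : Matrix ρ γ F) : Matrix ρ γ F[X] :=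
  Matrix.of fun i j => Polynomial.C (Xc i j) * Polynomial.X + Polynomial.C (Yc i j)

/-- `Λ_k(λ) ⊗ I_n` where `Λ_k(λ) = (λ^{k-1}, …, λ, 1)ᵀ`. -/
def Lam (F : Type*) [RCLike F] (k n : ℕ) : Matrix (Fin k × Fin n) (Fin n) F[X] :=
  Matrix.of fun p c => if p.2 = c then Polynomial.X ^ (k - 1 - (p.1 : ℕ)) else 0

/-- `Λ_k(λ)ᵀ ⊗ I_m`. -/
def LamRow (F : Type*) [RCLike F] (k m : ℕ) : Matrix (Fin m) (Fin k × Fin m) F[X] :=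
  Matrix.of fun r p => if r = p.2 then Polynomial.X ^ (k - 1 - (p.1 : ℕ)) else 0

/-- `v ⊗ P(λ)`. -/
def vkron {k m n : ℕ} (v : Fin k → F) (P : Matrix (Fin m) (Fin n) F[X]) :
    Matrix (Fin k × Fin m) (Fin n) F[X] :=
  Matrix.of fun p c => Polynomial.C (v p.1) * P p.2 c

/-- `wᵀ ⊗ P(λ)`. -/
def wkron {k m n : ℕ} (w : Fin k → F) (P : Matrix (Fin m) (Fin n) F[X]) :
    Matrix (Fin m) (Fin k × Fin n) F[X] :=
  Matrix.of fun r q => Polynomial.C (w q.1) * P r q.2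

/-- The defining identity of `𝕃₁(P)`: `L(λ)(Λ_k(λ) ⊗ I_n) = v ⊗ P(λ)`. -/
def RightAnsatz {k m n : ℕ} (P : Matrix (Fin m) (Fin n) F[X])
    (L : Matrix (Fin k × Fin m) (Fin k × Fin n) F[X]) (v : Fin k → F) : Prop :=
  L * Lam F k n = vkron v P

/-- The defining identity of `𝕃₂(P)`: `(Λ_k(λ)ᵀ ⊗ I_m) L(λ) = wᵀ ⊗ P(λ)`. -/
def LeftAnsatz {k m n : ℕ} (P : Matrix (Fin m) (Fin n) F[X])
    (L : Matrix (Fin k × Fin m) (Fin k × Fin n) F[X]) (w : Fin k → F) : Prop :=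
  LamRow F k m * L = wkron w P

/-- The vector `α e₁ ∈ F^k`. -/
def e1 {k : ℕ} (α : F) : Fin k → F := fun i => if (i : ℕ) = 0 then α else 0

/-- `M ⊗ I_m`. -/
def kronId {k m : ℕ} (M : Matrix (Fin k) (Fin k) F) :
    Matrix (Fin k × Fin m) (Fin k × Fin m) F :=
  Matrix.of fun p q => if p.2 = q.2 then M p.1 q.1 else 0

/-! ### (strong) g-linearizations -/

/-- `diag(P(λ), I_{k-1} ⊗ I_{m,n})`. -/
def glinTarget {k m n : ℕ} (P : Matrix (Fin m) (Fin n) F[X]) :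
    Matrix (Fin k × Fin m) (Fin k × Fin n) F[X] :=
  Matrix.of fun p q =>
    if p.1 = q.1 then
      (if (p.1 : ℕ) = 0 then P p.2 q.2 else if (p.2 : ℕ) = (q.2 : ℕ) then 1 else 0)
    else 0

/-- A `km × kn` pencil (or matrix polynomial) `L` is a g-linearization of the `m × n`
matrix polynomial `P` of grade `k` if `E(λ) L(λ) G(λ) = diag(P(λ), I_{k-1} ⊗ I_{m,n})`
for unimodular `E`, `G`. -/
def IsGLin {k m n : ℕ} (P : Matrix (Fin m) (Fin n) F[X])
    (L : Matrix (Fin k × Fin m) (Fin k × Fin n) F[X]) : Prop :=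
  ∃ (E : Matrix (Fin k × Fin m) (Fin k × Fin m) F[X])
    (G : Matrix (Fin k × Fin n) (Fin k × Fin n) F[X]),
      IsUnit E.det ∧ IsUnit G.det ∧ E * L * G = glinTarget P

/-- grade-`N` reversal `rev_N P(λ) = λ^N P(1/λ)`, entrywise. -/
def revMat {ρ γ : Type*} (N : ℕ) (P : Matrix ρ γ F[X]) : Matrix ρ γ F[X] :=
  P.map fun p => Polynomial.reflect N p

/-- Strong g-linearization of the grade-`k` matrix polynomial with coefficients `A`. -/
def IsStrongGLin {k m n : ℕ} (A : Fin (k + 1) → Matrix (Fin m) (Fin n) F)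
    (L : Matrix (Fin k × Fin m) (Fin k × Fin n) F[X]) : Prop :=
  IsGLin (matPoly A) L ∧ IsGLin (revMat k (matPoly A)) (revMat 1 L)

/-! ### linearizations (rectangular, of size `(m+s) × (n+s)`) -/

/-- A matrix polynomial `L` (indexed by arbitrary finite types of cardinalities
`m + s` and `n + s`) is a linearization of `P` if, after identifying the index types
with `Fin m ⊕ Fin s` and `Fin n ⊕ Fin s`, one has `E(λ) L(λ) G(λ) = diag(P(λ), I_s)`
for unimodular `E`, `G`. -/
def IsLin {m n : ℕ} (s : ℕ) (P : Matrix (Fin m) (Fin n) F[X])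
    {ρ γ : Type*} [Fintype ρ] [DecidableEq ρ] [Fintype γ] [DecidableEq γ]
    (L : Matrix ρ γ F[X]) : Prop :=
  ∃ (er : ρ ≃ (Fin m ⊕ Fin s)) (ec : γ ≃ (Fin n ⊕ Fin s))
    (E : Matrix (Fin m ⊕ Fin s) (Fin m ⊕ Fin s) F[X])
    (G : Matrix (Fin n ⊕ Fin s) (Fin n ⊕ Fin s) F[X]),
      IsUnit E.det ∧ IsUnit G.det ∧
        E * Matrix.reindex er ec L * G = Matrix.fromBlocks P 0 0 1

/-- Strong linearization of the grade-`k` matrix polynomial with coefficients `A`. -/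
def IsStrongLin {k m n : ℕ} (s : ℕ) (A : Fin (k + 1) → Matrix (Fin m) (Fin n) F)
    {ρ γ : Type*} [Fintype ρ] [DecidableEq ρ] [Fintype γ] [DecidableEq γ]
    (L : Matrix ρ γ F[X]) : Prop :=
  IsLin s (matPoly A) L ∧ IsLin s (revMat k (matPoly A)) (revMat 1 L)

/-! ### shifted sums -/

/-- Column shifted sum `X ⊞→ Y`. -/
def colShiftSum {k m n : ℕ} (Xc Yc : Matrix (Fin k × Fin m) (Fin k × Fin n) F) :
    Matrix (Fin k × Fin m) (Fin (k + 1) × Fin n) F :=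
  Matrix.of fun p q =>
    (if h : (q.1 : ℕ) < k then Xc p (⟨(q.1 : ℕ), h⟩, q.2) else 0) +
    (if h : 0 < (q.1 : ℕ) then
        Yc p (⟨(q.1 : ℕ) - 1, by have := q.1.isLt; omega⟩, q.2)
      else 0)

/-- Row shifted sum `X ⊞↓ Y`. -/
def rowShiftSum {k m n : ℕ} (Xc Yc : Matrix (Fin k × Fin m) (Fin k × Fin n) F) :
    Matrix (Fin (k + 1) × Fin m) (Fin k × Fin n) F :=
  Matrix.of fun p q =>
    (if h : (p.1 : ℕ) < k then Xc (⟨(p.1 : ℕ), h⟩, p.2) q else 0) +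
    (if h : 0 < (p.1 : ℕ) then
        Yc (⟨(p.1 : ℕ) - 1, by have := p.1.isLt; omega⟩, p.2) q
      else 0)

/-! ### the parametrization of `𝕃₁(P)` and `𝕃₂(P)` -/

/-- `X = [v ⊗ A_k ∣ -W]`. -/
def L1X {k m n : ℕ} (A : Fin (k + 1) → Matrix (Fin m) (Fin n) F) (v : Fin k → F)
    (W : Matrix (Fin k × Fin m) (Fin (k - 1) × Fin n) F) :
    Matrix (Fin k × Fin m) (Fin k × Fin n) F :=
  Matrix.of fun p q =>
    if h : (q.1 : ℕ) = 0 then v p.1 * A (Fin.last k) p.2 q.2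
    else -W p (⟨(q.1 : ℕ) - 1, by have := q.1.isLt; omega⟩, q.2)

/-- `Y = [W + v ⊗ [A_{k-1} ⋯ A_1] ∣ v ⊗ A_0]`. -/
def L1Y {k m n : ℕ} (A : Fin (k + 1) → Matrix (Fin m) (Fin n) F) (v : Fin k → F)
    (W : Matrix (Fin k × Fin m) (Fin (k - 1) × Fin n) F) :
    Matrix (Fin k × Fin m) (Fin k × Fin n) F :=
  Matrix.of fun p q =>
    if h : (q.1 : ℕ) < k - 1 then
      W p (⟨(q.1 : ℕ), h⟩, q.2) + v p.1 * A (⟨k - 1 - (q.1 : ℕ), by omega⟩) p.2 q.2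
    else v p.1 * A 0 p.2 q.2

/-- `X = [wᵀ ⊗ A_k ; -Ŵ]`. -/
def L2X {k m n : ℕ} (A : Fin (k + 1) → Matrix (Fin m) (Fin n) F) (w : Fin k → F)
    (W : Matrix (Fin (k - 1) × Fin m) (Fin k × Fin n) F) :
    Matrix (Fin k × Fin m) (Fin k × Fin n) F :=
  Matrix.of fun p q =>
    if h : (p.1 : ℕ) = 0 then w q.1 * A (Fin.last k) p.2 q.2
    else -W (⟨(p.1 : ℕ) - 1, by have := p.1.isLt; omega⟩, p.2) q

/-- `Y = [Ŵ + wᵀ ⊗ [A_{k-1}ᵀ ⋯ A_1ᵀ]ᵀ ; wᵀ ⊗ A_0]`. -/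
def L2Y {k m n : ℕ} (A : Fin (k + 1) → Matrix (Fin m) (Fin n) F) (w : Fin k → F)
    (W : Matrix (Fin (k - 1) × Fin m) (Fin k × Fin n) F) :
    Matrix (Fin k × Fin m) (Fin k × Fin n) F :=
  Matrix.of fun p q =>
    if h : (p.1 : ℕ) < k - 1 then
      W (⟨(p.1 : ℕ), h⟩, p.2) q + w q.1 * A (⟨k - 1 - (p.1 : ℕ), by omega⟩) p.2 q.2
    else w q.1 * A 0 p.2 q.2

/-! ### block structure and `Z`-matrices -/

/-- Assemble a `km × kn` matrix from blocks with row split `m + (k-1)m` and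
column split `n + (k-1)n`. -/
def blk {k m n : ℕ} (TL : Matrix (Fin m) (Fin n) F)
    (TR : Matrix (Fin m) (Fin (k - 1) × Fin n) F)
    (BL : Matrix (Fin (k - 1) × Fin m) (Fin n) F)
    (BR : Matrix (Fin (k - 1) × Fin m) (Fin (k - 1) × Fin n) F) :
    Matrix (Fin k × Fin m) (Fin k × Fin n) F :=
  Matrix.of fun p q =>
    if hp : (p.1 : ℕ) = 0 then
      if hq : (q.1 : ℕ) = 0 then TL p.2 q.2
      else TR p.2 (⟨(q.1 : ℕ) - 1, by have := q.1.isLt; omega⟩, q.2)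
    else
      if hq : (q.1 : ℕ) = 0 then
        BL (⟨(p.1 : ℕ) - 1, by have := p.1.isLt; omega⟩, p.2) q.2
      else
        BR (⟨(p.1 : ℕ) - 1, by have := p.1.isLt; omega⟩, p.2)
          (⟨(q.1 : ℕ) - 1, by have := q.1.isLt; omega⟩, q.2)

/-- Assemble `[[Y₁₁, T],[Z, 0]]`, row split `m + (k-1)m`, column split `(k-1)n + n`. -/
def blkY1 {k m n : ℕ} (Y11 : Matrix (Fin m) (Fin (k - 1) × Fin n) F)
    (T : Matrix (Fin m) (Fin n) F)
    (Z : Matrix (Fin (k - 1) × Fin m) (Fin (k - 1) × Fin n) F) :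
    Matrix (Fin k × Fin m) (Fin k × Fin n) F :=
  Matrix.of fun p q =>
    if hp : (p.1 : ℕ) = 0 then
      if hq : (q.1 : ℕ) < k - 1 then Y11 p.2 (⟨(q.1 : ℕ), hq⟩, q.2) else T p.2 q.2
    else
      if hq : (q.1 : ℕ) < k - 1 then
        Z (⟨(p.1 : ℕ) - 1, by have := p.1.isLt; omega⟩, p.2) (⟨(q.1 : ℕ), hq⟩, q.2)
      else 0

/-- Assemble `[[Y₁₁, Z],[T, 0]]`, row split `(k-1)m + m`, column split `n + (k-1)n`. -/
def blkY2 {k m n : ℕ} (Y11 : Matrix (Fin (k - 1) × Fin m) (Fin n) F)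
    (Z : Matrix (Fin (k - 1) × Fin m) (Fin (k - 1) × Fin n) F)
    (T : Matrix (Fin m) (Fin n) F) :
    Matrix (Fin k × Fin m) (Fin k × Fin n) F :=
  Matrix.of fun p q =>
    if hp : (p.1 : ℕ) < k - 1 then
      if hq : (q.1 : ℕ) = 0 then Y11 (⟨(p.1 : ℕ), hp⟩, p.2) q.2
      else Z (⟨(p.1 : ℕ), hp⟩, p.2) (⟨(q.1 : ℕ) - 1, by have := q.1.isLt; omega⟩, q.2)
    else
      if hq : (q.1 : ℕ) = 0 then T p.2 q.2 else 0

/-- The `Z`-matrix of `L = λX + Y ∈ 𝕃₁(P)` with respect to `M`: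
the lower-left `(k-1)m × (k-1)n` block of `(M ⊗ I_m) Y`. -/
def Zmat1 {k m n : ℕ} (M : Matrix (Fin k) (Fin k) F)
    (Yc : Matrix (Fin k × Fin m) (Fin k × Fin n) F) :
    Matrix (Fin (k - 1) × Fin m) (Fin (k - 1) × Fin n) F :=
  Matrix.of fun p q =>
    (kronId M * Yc : Matrix (Fin k × Fin m) (Fin k × Fin n) F)
      (⟨(p.1 : ℕ) + 1, by have := p.1.isLt; omega⟩, p.2)
      (⟨(q.1 : ℕ), by have := q.1.isLt; omega⟩, q.2)

/-- The `Z`-matrix of `L = λX + Y ∈ 𝕃₂(P)` with respect to `M̂`: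
the upper-right `(k-1)m × (k-1)n` block of `Y (M̂ᵀ ⊗ I_n)`. -/
def Zmat2 {k m n : ℕ} (M : Matrix (Fin k) (Fin k) F)
    (Yc : Matrix (Fin k × Fin m) (Fin k × Fin n) F) :
    Matrix (Fin (k - 1) × Fin m) (Fin (k - 1) × Fin n) F :=
  Matrix.of fun p q =>
    (Yc * kronId Mᵀ : Matrix (Fin k × Fin m) (Fin k × Fin n) F)
      (⟨(p.1 : ℕ), by have := p.1.isLt; omega⟩, p.2)
      (⟨(q.1 : ℕ) + 1, by have := q.1.isLt; omega⟩, q.2)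

/-- `L = λX + Y ∈ 𝕃₁(P)` with right ansatz vector `v` has full `Z`-rank. -/
def FullZrank1 {k m n : ℕ} (Yc : Matrix (Fin k × Fin m) (Fin k × Fin n) F)
    (v : Fin k → F) : Prop :=
  ∃ (M : Matrix (Fin k) (Fin k) F) (α : F),
    IsUnit M ∧ α ≠ 0 ∧ M.mulVec v = e1 α ∧ (Zmat1 M Yc).rank = (k - 1) * n

/-- `L = λX + Y ∈ 𝕃₂(P)` with left ansatz vector `w` has full `Z`-rank. -/
def FullZrank2 {k m n : ℕ} (Yc : Matrix (Fin k × Fin m) (Fin k × Fin n) F)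
    (w : Fin k → F) : Prop :=
  ∃ (M : Matrix (Fin k) (Fin k) F) (α : F),
    IsUnit M ∧ α ≠ 0 ∧ M.mulVec w = e1 α ∧ (Zmat2 M Yc).rank = (k - 1) * m

/-! ### null spaces, minimal bases and minimal indices over `F(λ)` -/

/-- A matrix polynomial viewed as a matrix over the field of rational functions. -/
def matRF {ρ γ : Type*} (P : Matrix ρ γ F[X]) : Matrix ρ γ (RatFunc F) :=
  P.map (algebraMap F[X] (RatFunc F))

/-- The right null space `N_r(P) = {x(λ) : P(λ) x(λ) ≡ 0}` over `F(λ)`. -/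
def Nr {ρ γ : Type*} [Fintype γ] (P : Matrix ρ γ F[X]) :
    Submodule (RatFunc F) (γ → RatFunc F) :=
  LinearMap.ker (Matrix.mulVecLin (matRF P))

/-- The left null space `N_l(P) = {y(λ) : y(λ)ᵀ P(λ) ≡ 0}` over `F(λ)`. -/
def Nl {ρ γ : Type*} [Fintype ρ] (P : Matrix ρ γ F[X]) :
    Submodule (RatFunc F) (ρ → RatFunc F) :=
  Nr Pᵀ

/-- The normal rank of a matrix polynomial: its rank over `F(λ)`. -/
def nrank {ρ γ : Type*} [Fintype γ] (P : Matrix ρ γ F[X]) : ℕ :=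
  (matRF P).rank

/-- The rational vector determined by a vector polynomial. -/
def polyVec {γ : Type*} (x : γ → F[X]) : γ → RatFunc F :=
  fun i => algebraMap F[X] (RatFunc F) (x i)

/-- A rational vector is a vector polynomial if all its entries are polynomials. -/
def IsVecPoly {γ : Type*} (x : γ → RatFunc F) : Prop :=
  ∃ p : γ → F[X], x = polyVec p

/-- The degree of a vector polynomial: the greatest degree of its components. -/
def polyVecDeg {γ : Type*} [Fintype γ] (x : γ → F[X]) : ℕ :=
  Finset.univ.sup fun i => (x i).natDegree

/-- A polynomial basis of the subspace `V` of `F(λ)^γ`. -/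
def IsPolyBasis {γ ι : Type*} [Fintype γ]
    (V : Submodule (RatFunc F) (γ → RatFunc F)) (b : ι → γ → F[X]) : Prop :=
  LinearIndependent (RatFunc F) (fun i => polyVec (b i)) ∧
    Submodule.span (RatFunc F) (Set.range fun i => polyVec (b i)) = V

/-- A minimal basis of `V`: a polynomial basis of least order (sum of degrees). -/
def IsMinimalBasis {γ ι : Type*} [Fintype γ] [Fintype ι]
    (V : Submodule (RatFunc F) (γ → RatFunc F)) (b : ι → γ → F[X]) : Prop :=
  IsPolyBasis V b ∧
    ∀ (d : ℕ) (b' : Fin d → γ → F[X]), IsPolyBasis V b' →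
      ∑ i, polyVecDeg (b i) ≤ ∑ i, polyVecDeg (b' i)

/-- `ε` is the list of minimal indices of `V`: some minimal basis of `V` has
`ε` as its list of degrees. -/
def HasMinIndices {γ : Type*} [Fintype γ]
    (V : Submodule (RatFunc F) (γ → RatFunc F)) {d : ℕ} (ε : Fin d → ℕ) : Prop :=
  ∃ b : Fin d → γ → F[X], IsMinimalBasis V b ∧ ∀ i, polyVecDeg (b i) = ε i

/-- `Λ_k(λ) ⊗ x(λ)`. -/
def lamTensor {n : ℕ} (k : ℕ) (x : Fin n → RatFunc F) : Fin k × Fin n → RatFunc F :=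
  fun p => algebraMap F[X] (RatFunc F) (Polynomial.X ^ (k - 1 - (p.1 : ℕ))) * x p.2

/-- The matrix `vᵀ ⊗ I_m` over `F(λ)`; `𝓛_v(y) = (vproj v).mulVec y`. -/
def vproj {k m : ℕ} (v : Fin k → F) : Matrix (Fin m) (Fin k × Fin m) (RatFunc F) :=
  Matrix.of fun r p =>
    if r = p.2 then algebraMap F[X] (RatFunc F) (Polynomial.C (v p.1)) else 0

/-- `(vᵀ ⊗ I_m) y` at the level of vector polynomials. -/
def LvPoly {k m : ℕ} (v : Fin k → F) (y : Fin k × Fin m → F[X]) : Fin m → F[X] :=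
  fun r => ∑ i : Fin k, Polynomial.C (v i) * y (i, r)

/-- The rational subspace spanned by the rows of a matrix polynomial. -/
def rowSpan {ρ γ : Type*} [Fintype γ] (B : Matrix ρ γ F[X]) :
    Submodule (RatFunc F) (γ → RatFunc F) :=
  Submodule.span (RatFunc F) (Set.range fun i => polyVec (B i))

/-- A matrix polynomial is a minimal basis if its rows form a minimal basis of the
rational subspace they span. -/
def IsMinimalBasisMat {ρ γ : Type*} [Fintype ρ] [Fintype γ] (B : Matrix ρ γ F[X]) : Prop :=
  IsMinimalBasis (rowSpan B) (fun i => B i)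

/-- Dual minimal bases: `B ∈ F[λ]^{n₁×n}`, `C ∈ F[λ]^{n₂×n}` minimal bases with
`n₁ + n₂ = n` and `B Cᵀ = 0`. -/
def DualMinBases {ρ ρ' γ : Type*} [Fintype ρ] [Fintype ρ'] [Fintype γ]
    (B : Matrix ρ γ F[X]) (Cm : Matrix ρ' γ F[X]) : Prop :=
  IsMinimalBasisMat B ∧ IsMinimalBasisMat Cm ∧
    Fintype.card ρ + Fintype.card ρ' = Fintype.card γ ∧ B * Cmᵀ = 0

/-! ### norms, singular values -/

/-- Square of the Frobenius norm of a constant matrix. -/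
def frobSq {ρ γ : Type*} [Fintype ρ] [Fintype γ] (Ac : Matrix ρ γ F) : ℝ :=
  ∑ i, ∑ j, ‖Ac i j‖ ^ 2

/-- `‖λX + Y‖_F = sqrt(‖X‖_F² + ‖Y‖_F²)`. -/
def penFrob {ρ γ : Type*} [Fintype ρ] [Fintype γ] (Xc Yc : Matrix ρ γ F) : ℝ :=
  Real.sqrt (frobSq Xc + frobSq Yc)

/-- `‖P‖_F = sqrt(∑ ‖A_i‖_F²)` for `P(λ) = ∑ λ^i A_i`. -/
def famFrob {k m n : ℕ} (A : Fin (k + 1) → Matrix (Fin m) (Fin n) F) : ℝ :=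
  Real.sqrt (∑ i, frobSq (A i))

/-- `‖P‖_F` for a matrix polynomial of grade `g`. -/
def mpolyFrob {ρ γ : Type*} [Fintype ρ] [Fintype γ] (g : ℕ) (P : Matrix ρ γ F[X]) : ℝ :=
  Real.sqrt (∑ i, ∑ j, ∑ d ∈ Finset.range (g + 1), ‖(P i j).coeff d‖ ^ 2)

/-- Square of the Euclidean norm of a vector. -/
def vecNormSq {ι : Type*} [Fintype ι] (x : ι → F) : ℝ := ∑ i, ‖x i‖ ^ 2

/-- The smallest singular value of a matrix. -/
def sigmaMin {ρ γ : Type*} [Fintype ρ] [Fintype γ] (Ac : Matrix ρ γ F) : ℝ :=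
  if Fintype.card γ ≤ Fintype.card ρ then
    sInf {r : ℝ | ∃ x : γ → F, vecNormSq x = 1 ∧ r = Real.sqrt (vecNormSq (Ac.mulVec x))}
  else
    sInf {r : ℝ | ∃ y : ρ → F, vecNormSq y = 1 ∧ r = Real.sqrt (vecNormSq (Acᴴ.mulVec y))}

/-- The spectral norm (2-norm) of a matrix. -/
def norm2 {ρ γ : Type*} [Fintype ρ] [Fintype γ] (Ac : Matrix ρ γ F) : ℝ :=
  sSup {r : ℝ | ∃ x : γ → F, vecNormSq x = 1 ∧ r = Real.sqrt (vecNormSq (Ac.mulVec x))}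

/-- `κ₂(D) = ‖D‖₂ ‖D⁻¹‖₂`. -/
def cond2 {ρ : Type*} [Fintype ρ] [DecidableEq ρ] (Dc : Matrix ρ ρ F) : ℝ :=
  norm2 Dc * norm2 Dc⁻¹

/-! ### pencils used in the backward error analysis -/

/-- `B(λ) = λ [0 ∣ -R̃] + [R̃ ∣ 0]`, i.e. `R̃ (H_{k-1}(λ) ⊗ I_n)` up to sign conventions. -/
def Bpencil {k n : ℕ} (R : Matrix (Fin (k - 1) × Fin n) (Fin (k - 1) × Fin n) F) :
    Matrix (Fin (k - 1) × Fin n) (Fin k × Fin n) F[X] :=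
  Matrix.of fun p q =>
    (if h : (q.1 : ℕ) < k - 1 then Polynomial.C (R p (⟨(q.1 : ℕ), h⟩, q.2)) else 0) +
    (if h : 0 < (q.1 : ℕ) then
        Polynomial.X *
          Polynomial.C (-R p (⟨(q.1 : ℕ) - 1, by have := q.1.isLt; omega⟩, q.2))
      else 0)

/-- The coefficient of `λ` in `H_{k-1}(λ) ⊗ I_n`. -/
def Hlam (F : Type*) [RCLike F] (k n : ℕ) :
    Matrix (Fin (k - 1) × Fin n) (Fin k × Fin n) F :=
  Matrix.of fun p q => if p.2 = q.2 ∧ (q.1 : ℕ) = (p.1 : ℕ) + 1 then 1 else 0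

/-- The constant coefficient of `H_{k-1}(λ) ⊗ I_n`. -/
def Hconst (F : Type*) [RCLike F] (k n : ℕ) :
    Matrix (Fin (k - 1) × Fin n) (Fin k × Fin n) F :=
  Matrix.of fun p q => if p.2 = q.2 ∧ (q.1 : ℕ) = (p.1 : ℕ) then -1 else 0

/-- The convolution matrix `C_j(λ Xc + Yc)` of a pencil, with `j+1` block columns. -/
def convPencil {ρ γ : Type*} (Xc Yc : Matrix ρ γ F) (j : ℕ) :
    Matrix (Fin (j + 2) × ρ) (Fin (j + 1) × γ) F :=
  Matrix.of fun r c =>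
    if (r.1 : ℕ) = (c.1 : ℕ) then Xc r.2 c.2
    else if (r.1 : ℕ) = (c.1 : ℕ) + 1 then Yc r.2 c.2 else 0

/-- λ-coefficient of the trimmed pencil `L̂_t(λ)`:
`[[α A_k, X₁₂],[0, -R̃]]` with row split `m + (k-1)n`. -/
def LtX {k m n : ℕ} (α : F) (Ak : Matrix (Fin m) (Fin n) F)
    (X12 : Matrix (Fin m) (Fin (k - 1) × Fin n) F)
    (R : Matrix (Fin (k - 1) × Fin n) (Fin (k - 1) × Fin n) F) :
    Matrix (Fin m ⊕ (Fin (k - 1) × Fin n)) (Fin k × Fin n) F :=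
  Matrix.of fun s q =>
    Sum.elim
      (fun r => if h : (q.1 : ℕ) = 0 then α * Ak r q.2
        else X12 r (⟨(q.1 : ℕ) - 1, by have := q.1.isLt; omega⟩, q.2))
      (fun p => if h : (q.1 : ℕ) = 0 then 0
        else -R p (⟨(q.1 : ℕ) - 1, by have := q.1.isLt; omega⟩, q.2)) s

/-- Constant coefficient of the trimmed pencil `L̂_t(λ)`:
`[[Y₁₁, α A₀],[R̃, 0]]` with row split `m + (k-1)n`. -/
def LtY {k m n : ℕ} (α : F) (A0 : Matrix (Fin m) (Fin n) F)
    (Y11 : Matrix (Fin m) (Fin (k - 1) × Fin n) F)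
    (R : Matrix (Fin (k - 1) × Fin n) (Fin (k - 1) × Fin n) F) :
    Matrix (Fin m ⊕ (Fin (k - 1) × Fin n)) (Fin k × Fin n) F :=
  Matrix.of fun s q =>
    Sum.elim
      (fun r => if h : (q.1 : ℕ) < k - 1 then Y11 r (⟨(q.1 : ℕ), h⟩, q.2)
        else α * A0 r q.2)
      (fun p => if h : (q.1 : ℕ) < k - 1 then R p (⟨(q.1 : ℕ), h⟩, q.2) else 0) s

/-! ### trimming -/

/-- The rows `[0 ∣ Q₂*] (M ⊗ I_m)`. -/
def bottomRows {k m n c : ℕ} (M : Matrix (Fin k) (Fin k) F)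
    (Q : Matrix (Fin (k - 1) × Fin m) ((Fin (k - 1) × Fin n) ⊕ Fin c) F) :
    Matrix (Fin c) (Fin k × Fin m) F :=
  (Matrix.of fun (j : Fin c) (p : Fin k × Fin m) =>
      if h : (p.1 : ℕ) = 0 then 0
      else star (Q (⟨(p.1 : ℕ) - 1, by have := p.1.isLt; omega⟩, p.2) (Sum.inr j)))
    * kronId M

/-- The square matrix `[D ; [0 ∣ Q₂*](M ⊗ I_m)]` whose invertibility makes `D` admissible. -/
def trimAux {k m n c : ℕ} (M : Matrix (Fin k) (Fin k) F)
    (Q : Matrix (Fin (k - 1) × Fin m) ((Fin (k - 1) × Fin n) ⊕ Fin c) F)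
    (D : Matrix (Fin m ⊕ (Fin (k - 1) × Fin n)) (Fin k × Fin m) F) :
    Matrix ((Fin m ⊕ (Fin (k - 1) × Fin n)) ⊕ Fin c) (Fin k × Fin m) F :=
  Matrix.of (Sum.elim (fun i j => D i j) (fun i j => bottomRows M Q i j))

/-- The columns `(M̂ᵀ ⊗ I_n) [0 ; Q₂]`. -/
def rightCols {k m n c : ℕ} (M : Matrix (Fin k) (Fin k) F)
    (Q : Matrix (Fin (k - 1) × Fin n) ((Fin (k - 1) × Fin m) ⊕ Fin c) F) :
    Matrix (Fin k × Fin n) (Fin c) F :=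
  kronId Mᵀ *
    (Matrix.of fun (q : Fin k × Fin n) (j : Fin c) =>
      if h : (q.1 : ℕ) = 0 then 0
      else Q (⟨(q.1 : ℕ) - 1, by have := q.1.isLt; omega⟩, q.2) (Sum.inr j))

/-- The square matrix `[D̂ ∣ (M̂ᵀ ⊗ I_n)[0 ; Q₂]]` whose invertibility makes `D̂` admissible. -/
def trimAux2 {k m n c : ℕ} (M : Matrix (Fin k) (Fin k) F)
    (Q : Matrix (Fin (k - 1) × Fin n) ((Fin (k - 1) × Fin m) ⊕ Fin c) F)
    (D : Matrix (Fin k × Fin n) (Fin n ⊕ (Fin (k - 1) × Fin m)) F) :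
    Matrix (Fin k × Fin n) ((Fin n ⊕ (Fin (k - 1) × Fin m)) ⊕ Fin c) F :=
  Matrix.of fun q s => Sum.elim (fun t => D q t) (fun j => rightCols M Q q j) s

/-! ### auxiliary results -/

/-- A vector polynomial annihilated by `(λ^{k-1}, …, λ, 1)` telescopes as
`g_i = s_{i+1} - λ s_i` with `s_0 = s_k = 0`, and `s` has degree one less than `g`. -/
theorem exists_telescope {k d : ℕ} (g : Fin k → F[X]) (hdeg : ∀ i, (g i).natDegree ≤ d + 1)
    (h : ∑ i : Fin k, (X : F[X]) ^ (k - 1 - (i : ℕ)) * g i = 0) :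
    ∃ s : ℕ → F[X], s 0 = 0 ∧ s k = 0 ∧ (∀ i : Fin k, g i = s (i + 1) - X * s i) ∧
      ∀ i ≤ k, (s i).natDegree ≤ d := by
  let g' : ℕ → F[X] := fun i => if hi : i < k then g ⟨i, hi⟩ else 0
  let s : ℕ → F[X] := fun i => Nat.rec 0 (fun j sj => g' j + X * sj) i
  have hs : ∀ i, s (i + 1) = g' i + X * s i := fun i => rfl
  have hclosed : ∀ i, s i = ∑ j ∈ Finset.range i, X ^ (i - 1 - j) * g' j := by
    intro i
    induction i with
    | zero => rfl
    | succ i ih =>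
      rw [hs, ih, Finset.sum_range_succ, Finset.mul_sum, add_comm]
      congr 1
      · refine Finset.sum_congr rfl fun j hj => ?_
        have hj := Finset.mem_range.1 hj
        rw [← mul_assoc, ← pow_succ']
        congr 2
        omega
      · simp
  have hk : s k = 0 := by
    rw [hclosed, ← h, Finset.sum_range]
    simp [g']
  have hstep : ∀ i : Fin k, g i = s (i + 1) - X * s i := by
    intro i
    rw [hs]
    simp [g']
  refine ⟨s, rfl, hk, hstep, fun i hi => ?_⟩
  induction hi using Nat.decreasingInduction with
  | self => simp [hk]
  | of_succ i hi ih =>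
    have e : X * s i = s (i + 1) - g ⟨i, hi⟩ := by rw [hstep ⟨i, hi⟩]; ring
    rcases eq_or_ne (s i) 0 with h0 | h0
    · simp [h0]
    · have h1 := natDegree_X_mul h0
      have h2 := natDegree_sub_le (s (i + 1)) (g ⟨i, hi⟩)
      have h3 := hdeg ⟨i, hi⟩
      rw [← e, h1] at h2
      have := max_le (ih.trans (Nat.le_succ d)) h3
      omega

theorem natDegree_le_polyVecDeg {γ : Type*} [Fintype γ] (y : γ → F[X]) (i : γ) :
    (y i).natDegree ≤ polyVecDeg y :=
  Finset.le_sup (f := fun i => (y i).natDegree) (Finset.mem_univ i)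

theorem polyVecDeg_le {γ : Type*} [Fintype γ] {y : γ → F[X]} {d : ℕ}
    (h : ∀ i, (y i).natDegree ≤ d) : polyVecDeg y ≤ d :=
  Finset.sup_le fun i _ => h i

/-- A null vector of `P` lifts, without increasing the degree, to a null vector of a pencil
in `𝕃₂(P)` with ansatz vector `α e₁` whose `Z`-block has a right inverse. -/
theorem exists_lift_e1 {k m n : ℕ} {P : Matrix (Fin m) (Fin n) F[X]}
    {Xc Yc : Matrix (Fin (k + 1) × Fin m) (Fin (k + 1) × Fin n) F} {α : F} (hα : α ≠ 0)
    (hL : LeftAnsatz P (pencil Xc Yc) (e1 α))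
    {R : Matrix (Fin k × Fin n) (Fin k × Fin m) F}
    (hR : (Matrix.of fun (p : Fin k × Fin m) (q : Fin k × Fin n) =>
      Yc (p.1.castSucc, p.2) (q.1.succ, q.2)) * R = 1)
    {y : Fin n → F[X]} (hy : P *ᵥ y = 0) :
    ∃ z : Fin (k + 1) × Fin n → F[X], pencil Xc Yc *ᵥ z = 0 ∧
      polyVecDeg z ≤ polyVecDeg y ∧ ∀ c, C α * z (0, c) = y c := by
  set d := polyVecDeg y
  have hLe : ∀ r q, ∑ i : Fin (k + 1), (X : F[X]) ^ (k + 1 - 1 - (i : ℕ)) *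
      pencil Xc Yc (i, r) q = C (e1 α q.1) * P r q.2 := by
    intro r q
    have := congrFun (congrFun hL r) q
    simpa [Matrix.mul_apply, LamRow, wkron, Fintype.sum_prod_type, ite_mul] using this
  have hpdeg : ∀ p q, (pencil Xc Yc p q).natDegree ≤ 1 := fun p q => natDegree_linear_le
  let y0 : Fin n → F[X] := fun c => C α⁻¹ * y c
  have hy0 : ∀ c, (y0 c).natDegree ≤ d := fun c =>
    (natDegree_C_mul_le _ _).trans (natDegree_le_polyVecDeg y c)
  have hS := fun r : Fin m => exists_telescope (d := d)
    (fun i : Fin (k + 1) => ∑ c, pencil Xc Yc (i, r) (0, c) * y0 c)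
    (fun i => natDegree_sum_le_of_forall_le _ _ fun c _ =>
      natDegree_mul_le.trans (by have := hpdeg (i, r) (0, c); have := hy0 c; omega))
    (by
      simp only [Finset.mul_sum, ← mul_assoc]
      rw [Finset.sum_comm]
      simp only [← Finset.sum_mul, hLe]
      have := congrFun hy r
      simp only [Matrix.mulVec, dotProduct, Pi.zero_apply] at this
      rw [← this]
      refine Finset.sum_congr rfl fun c _ => ?_
      have hc : (C α : F[X]) * C α⁻¹ = 1 := by rw [← C_mul, mul_inv_cancel₀ hα, C_1]
      simp only [e1, y0, Fin.val_zero, if_true]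
      linear_combination (P r c * y c) * hc)
  choose S hS0 hSk hS hSdeg using hS
  have hT := fun (r : Fin m) (q : Fin k × Fin n) => exists_telescope (d := 0)
    (fun i : Fin (k + 1) => pencil Xc Yc (i, r) (q.1.succ, q.2))
    (fun i => hpdeg _ _) (by rw [hLe]; simp [e1])
  choose T hT0 hTk hT hTdeg using hT
  have hTC : ∀ r q (i : Fin (k + 1)), T r q (i + 1) = C (Yc (i, r) (q.1.succ, q.2)) := by
    intro r q i
    have h1 := eq_C_of_natDegree_le_zero (hTdeg r q (i + 1) i.isLt)
    have h2 := congrArg (fun p : F[X] => p.coeff 0) (hT r q i)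
    simp [pencil] at h2
    rw [h1, h2]
  let t : Fin k × Fin n → F[X] := fun q => ∑ p, C (R q p) * -(S p.2 (p.1 + 1))
  have hE : ∀ r, ∀ i ≤ k + 1, ∑ q, T r q i * t q = -S r i := by
    intro r i hi
    rcases i with _ | i
    · simp [hT0, hS0]
    · rcases Nat.lt_or_ge i k with hik | hik
      · have h1 : ∀ q, T r q (i + 1) = C (Yc ((⟨i, hik⟩ : Fin k).castSucc, r) (q.1.succ, q.2)) :=
          fun q => hTC r q (⟨i, hik⟩ : Fin k).castSucc
        simp only [h1, t, Finset.mul_sum, ← mul_assoc, ← C_mul]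
        rw [Finset.sum_comm]
        simp only [← Finset.sum_mul, ← map_sum]
        have h2 : ∀ p, ∑ q, Yc ((⟨i, hik⟩ : Fin k).castSucc, r) (q.1.succ, q.2) * R q p =
            (1 : Matrix (Fin k × Fin m) (Fin k × Fin m) F) (⟨i, hik⟩, r) p := by
          intro p
          rw [← hR, Matrix.mul_apply]
          rfl
        simp only [h2, Matrix.one_apply, apply_ite (C : F → F[X]), C_1, C_0, ite_mul, one_mul,
          zero_mul, Finset.sum_ite_eq, Finset.mem_univ, if_true]
      · obtain rfl : i = k := by omega
        simp [hTk, hSk]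
  refine ⟨fun p => Fin.cases (y0 p.2) (fun q => t (q, p.2)) p.1, ?_, ?_, ?_⟩
  · ext1 ⟨i, r⟩
    have h1 := hS r i
    have h2 := hE r i i.isLt.le
    have h3 := hE r (i + 1) i.isLt
    simp only [Matrix.mulVec, dotProduct, Fintype.sum_prod_type, Fin.sum_univ_succ,
      Fin.cases_zero, Fin.cases_succ, Pi.zero_apply]
    rw [h1, ← Fintype.sum_prod_type
      (f := fun q : Fin k × Fin n => pencil Xc Yc (i, r) (q.1.succ, q.2) * t q)]
    simp only [hT, sub_mul, Finset.sum_sub_distrib, mul_assoc, ← Finset.mul_sum]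
    rw [h2, h3]
    ring
  · refine polyVecDeg_le fun ⟨j, c⟩ => ?_
    refine Fin.cases (hy0 c) (fun q => ?_) j
    refine natDegree_sum_le_of_forall_le _ _ fun p _ => (natDegree_C_mul_le _ _).trans ?_
    rw [natDegree_neg]
    exact hSdeg _ _ (by omega)
  · intro c
    simp only [Fin.cases_zero, y0, ← mul_assoc, ← C_mul, mul_inv_cancel₀ hα, C_1, one_mul]

theorem exists_right_inverse_of_rank_eq {ρ γ : Type*} [Fintype ρ] [DecidableEq ρ] [Fintype γ]
    [DecidableEq γ] {B : Matrix ρ γ F} (h : B.rank = Fintype.card ρ) :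
    ∃ R : Matrix γ ρ F, B * R = 1 := by
  rw [← Matrix.mulVec_surjective_iff_exists_right_inverse]
  have : LinearMap.range B.mulVecLin = ⊤ := by
    apply Submodule.eq_top_of_finrank_eq
    rw [Module.finrank_pi, ← h]
    rfl
  exact LinearMap.range_eq_top.1 this

/-- A null vector of `P` lifts along `𝓛_w`, without increasing the degree, to a null vector of
a pencil of full `Z`-rank in `𝕃₂(P)`. -/
theorem exists_lift {k m n : ℕ} (hk : 0 < k) {P : Matrix (Fin m) (Fin n) F[X]}
    {Xc Yc : Matrix (Fin k × Fin m) (Fin k × Fin n) F} {w : Fin k → F}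
    (hL : LeftAnsatz P (pencil Xc Yc) w) (hZ : FullZrank2 Yc w)
    {y : Fin n → F[X]} (hy : P *ᵥ y = 0) :
    ∃ z : Fin k × Fin n → F[X], pencil Xc Yc *ᵥ z = 0 ∧
      polyVecDeg z ≤ polyVecDeg y ∧ LvPoly w z = y := by
  obtain ⟨k, rfl⟩ : ∃ l, k = l + 1 := ⟨k - 1, by omega⟩
  obtain ⟨M, α, -, hα, hMw, hrank⟩ := hZ
  let K : Matrix (Fin (k + 1) × Fin n) (Fin (k + 1) × Fin n) F := kronId Mᵀ
  have hpK : pencil Xc Yc * K.map C = pencil (Xc * K) (Yc * K) := by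
    ext1 p q
    simp only [Matrix.mul_apply, pencil, Matrix.of_apply, Matrix.map_apply, map_sum, C_mul,
      Finset.sum_mul, ← Finset.sum_add_distrib]
    exact Finset.sum_congr rfl fun _ _ => by ring
  have hL' : LeftAnsatz P (pencil (Xc * K) (Yc * K)) (e1 α) := by
    unfold LeftAnsatz at hL ⊢
    rw [← hpK, ← Matrix.mul_assoc, hL, ← hMw]
    ext1 r q
    simp only [Matrix.mul_apply, wkron, Matrix.of_apply, Matrix.map_apply, K, kronId,
      Fintype.sum_prod_type, apply_ite (C : F → F[X]), C_0, mul_ite, mul_zero,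
      Finset.sum_ite_eq', Finset.mem_univ, if_true, Matrix.transpose_apply, Matrix.mulVec,
      dotProduct, map_sum, C_mul, Finset.sum_mul]
    exact Finset.sum_congr rfl fun _ _ => by ring
  obtain ⟨R, hR⟩ := exists_right_inverse_of_rank_eq (B := Zmat2 M Yc) (by simpa using hrank)
  obtain ⟨z, hz0, hzd, hzy⟩ := exists_lift_e1 hα hL' (R := R) hR hy
  refine ⟨K.map C *ᵥ z, ?_, ?_, ?_⟩
  · rw [Matrix.mulVec_mulVec, hpK, hz0]
  · refine (polyVecDeg_le fun p => ?_).trans hzd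
    refine natDegree_sum_le_of_forall_le _ _ fun q _ => (natDegree_C_mul_le _ _).trans ?_
    exact natDegree_le_polyVecDeg z q
  · ext1 c
    have h1 : ∀ q, ∑ i, C (w i) * C (M q i) = (C (e1 α q) : F[X]) := by
      intro q
      rw [← hMw]
      simp only [Matrix.mulVec, dotProduct, map_sum, C_mul, mul_comm]
    rw [← hzy c]
    simp only [LvPoly, Matrix.mulVec, dotProduct, K, kronId, Matrix.map_apply, Matrix.of_apply,
      Fintype.sum_prod_type, apply_ite (C : F → F[X]), C_0, ite_mul, zero_mul,
      Finset.sum_ite_eq, Finset.mem_univ, if_true, Matrix.transpose_apply, Finset.mul_sum,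
      ← mul_assoc]
    rw [Finset.sum_comm]
    simp only [← Finset.sum_mul, h1]
    rw [Fin.sum_univ_succ]
    simp [e1]

theorem exists_equiv_of_map_univ_eq {α β γ : Type*} [Fintype α] [Fintype β] {f : α → γ}
    {g : β → γ} (h : (Finset.univ : Finset α).val.map f = (Finset.univ : Finset β).val.map g) :
    ∃ e : α ≃ β, ∀ a, g (e a) = f a := by
  classical
  have hcard : ∀ c, Fintype.card {a // f a = c} = Fintype.card {b // g b = c} := by
    intro c
    have hc := congrArg (Multiset.count c) h
    rw [Multiset.count_map, Multiset.count_map] at hc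
    simp only [eq_comm (a := c)] at hc
    rw [Fintype.card_subtype, Fintype.card_subtype]
    exact hc
  let e : ∀ c, {a // f a = c} ≃ {b // g b = c} := fun c => Fintype.equivOfCardEq (hcard c)
  exact ⟨Equiv.ofFiberEquiv e, Equiv.ofFiberEquiv_map e⟩

section LinearAlgebra

variable {K E E' ι κ : Type*} [Field K] [AddCommGroup E] [Module K E] [AddCommGroup E']
  [Module K E']

/-- Vectors completing a basis of `V ⊓ ker f` to a basis of `V` have linearly independent
images spanning `f(V)`. -/
theorem linearIndependent_and_span_map {f : E →ₗ[K] E'} {V : Submodule K E} {x : ι → E}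
    {u : κ → E} (hli : LinearIndependent K (Sum.elim x u))
    (hsp : Submodule.span K (Set.range (Sum.elim x u)) = V)
    (hu : Submodule.span K (Set.range u) = V ⊓ LinearMap.ker f) :
    LinearIndependent K (f ∘ x) ∧ Submodule.span K (Set.range (f ∘ x)) = V.map f := by
  obtain ⟨hx, -, hdisj⟩ := linearIndependent_sum.1 hli
  simp only [Sum.elim_comp_inl, Sum.elim_comp_inr] at hx hdisj
  rw [Set.Sum.elim_range, Submodule.span_union] at hsp
  have hxV : Submodule.span K (Set.range x) ≤ V := hsp ▸ le_sup_left
  refine ⟨hx.map ?_, ?_⟩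
  · rw [Submodule.disjoint_def] at hdisj ⊢
    intro v hv hv'
    exact hdisj v hv (hu ▸ ⟨hxV hv, hv'⟩)
  · have h0 : (Submodule.span K (Set.range u)).map f = ⊥ := by
      rw [hu, eq_bot_iff, Submodule.map_le_iff_le_comap]
      exact fun v hv => hv.2
    rw [← hsp, Submodule.map_sup, h0, sup_bot_eq, Submodule.map_span, Set.range_comp]

/-- Preimages in `V` of a basis of `W ⊇ f(V)`, together with a basis of `V ⊓ ker f`, form a
basis of `V`. -/
theorem linearIndependent_and_span_sumElim {f : E →ₗ[K] E'} {V : Submodule K E}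
    {W : Submodule K E'} (hVW : V.map f ≤ W) {z : ι → E} {u : κ → E}
    (hzV : ∀ i, z i ∈ V) (hz : LinearIndependent K (f ∘ z))
    (hzW : Submodule.span K (Set.range (f ∘ z)) = W) (hli : LinearIndependent K u)
    (hu : Submodule.span K (Set.range u) = V ⊓ LinearMap.ker f) :
    LinearIndependent K (Sum.elim z u) ∧
      Submodule.span K (Set.range (Sum.elim z u)) = V := by
  have hspz : Submodule.span K (Set.range z) ≤ V :=
    Submodule.span_le.2 (Set.range_subset_iff.2 hzV)
  refine ⟨(LinearIndependent.of_comp f hz).sum_type hli ?_, ?_⟩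
  · have hker : Submodule.span K (Set.range u) ≤ LinearMap.ker f := hu.le.trans inf_le_right
    exact (Submodule.range_ker_disjoint hz).mono_right hker
  · rw [Set.Sum.elim_range, Submodule.span_union]
    refine le_antisymm (sup_le hspz (hu.le.trans inf_le_left)) fun v hv => ?_
    have hfv : f v ∈ (Submodule.span K (Set.range z)).map f := by
      rw [Submodule.map_span, ← Set.range_comp, hzW]
      exact hVW (Submodule.mem_map_of_mem hv)
    obtain ⟨v', hv', hfv'⟩ := hfv
    have : v - v' ∈ Submodule.span K (Set.range u) := by
      rw [hu]
      exact ⟨V.sub_mem hv (hspz hv'), by simp [hfv']⟩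
    rw [← add_sub_cancel v' v]
    exact Submodule.add_mem_sup hv' this

end LinearAlgebra

theorem isPolyBasis_append_iff {γ : Type*} [Fintype γ]
    {V : Submodule (RatFunc F) (γ → RatFunc F)} {d c : ℕ} {x : Fin d → γ → F[X]}
    {u : Fin c → γ → F[X]} :
    IsPolyBasis V (Fin.append x u) ↔
      LinearIndependent (RatFunc F)
          (Sum.elim (fun i => polyVec (x i)) fun j => polyVec (u j)) ∧
        Submodule.span (RatFunc F)
          (Set.range (Sum.elim (fun i => polyVec (x i)) fun j => polyVec (u j))) = V := by
  have h : (fun i => polyVec (Fin.append x u i)) ∘ finSumFinEquiv =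
      Sum.elim (fun i => polyVec (x i)) fun j => polyVec (u j) := by
    ext1 (i | j) <;> simp
  rw [← h, linearIndependent_equiv, EquivLike.range_comp]
  rfl

theorem polyVec_mem_Nr_iff {ρ γ : Type*} [Fintype γ] {P : Matrix ρ γ F[X]} {y : γ → F[X]} :
    polyVec y ∈ Nr P ↔ P *ᵥ y = 0 := by
  have h : matRF P *ᵥ polyVec y = polyVec (P *ᵥ y) := by
    ext1 i
    simp [matRF, polyVec, Matrix.mulVec, dotProduct]
  simp only [Nr, LinearMap.mem_ker, Matrix.mulVecLin_apply, h]
  constructor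
  · intro h0
    ext1 i
    exact (map_eq_zero_iff _ (IsFractionRing.injective F[X] (RatFunc F))).1 (congrFun h0 i)
  · rintro h0
    ext1 i
    simp [h0, polyVec]

theorem finrank_Nr {ρ γ : Type*} [Fintype ρ] [Fintype γ] (P : Matrix ρ γ F[X]) :
    Module.finrank (RatFunc F) (Nr P) = Fintype.card γ - nrank P := by
  have h := LinearMap.finrank_range_add_finrank_ker (Matrix.mulVecLin (matRF P))
  rw [Module.finrank_pi] at h
  exact Nat.eq_sub_of_add_eq' h

theorem vproj_mulVecLin_polyVec {k n : ℕ} (w : Fin k → F) (y : Fin k × Fin n → F[X]) :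
    Matrix.mulVecLin (vproj w) (polyVec y) = polyVec (LvPoly w y) := by
  ext1 r
  simp [vproj, polyVec, LvPoly, Matrix.mulVec, dotProduct, Fintype.sum_prod_type]

theorem map_vproj_Nr_le {k m n : ℕ} {P : Matrix (Fin m) (Fin n) F[X]}
    {L : Matrix (Fin k × Fin m) (Fin k × Fin n) F[X]} {w : Fin k → F}
    (hL : LeftAnsatz P L w) : (Nr L).map (Matrix.mulVecLin (vproj w)) ≤ Nr P := by
  rw [Submodule.map_le_iff_le_comap]
  intro v hv
  have hfac : matRF P * vproj (m := n) w = matRF (LamRow F k m) * matRF L := by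
    rw [matRF, matRF, matRF, ← Matrix.map_mul, hL]
    ext1 r q
    simp only [Matrix.mul_apply, vproj, wkron, Matrix.of_apply, Matrix.map_apply, mul_ite,
      mul_zero, Finset.sum_ite_eq', Finset.mem_univ, if_true, map_mul]
    exact mul_comm _ _
  have hv0 : matRF L *ᵥ v = 0 := hv
  show matRF P *ᵥ (vproj w *ᵥ v) = 0
  rw [Matrix.mulVec_mulVec, hfac, ← Matrix.mulVec_mulVec, hv0, Matrix.mulVec_zero]

theorem polyVecDeg_LvPoly_le {k n : ℕ} (w : Fin k → F) (y : Fin k × Fin n → F[X]) :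
    polyVecDeg (LvPoly w y) ≤ polyVecDeg y :=
  polyVecDeg_le fun r => natDegree_sum_le_of_forall_le _ _ fun i _ =>
    (natDegree_C_mul_le _ _).trans (natDegree_le_polyVecDeg y (i, r))

/-- The order of a minimal basis of `N_r(L)` is at most that of any polynomial basis
of `N_r(P)`. -/
theorem order_le_of_isPolyBasis {ι : Type*} [Fintype ι] {k m n c : ℕ} (hk : 0 < k)
    {P : Matrix (Fin m) (Fin n) F[X]} {Xc Yc : Matrix (Fin k × Fin m) (Fin k × Fin n) F}
    {w : Fin k → F} (hL : LeftAnsatz P (pencil Xc Yc) w) (hZ : FullZrank2 Yc w)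
    {u : Fin c → (Fin k × Fin n → F)}
    (hu₁ : LinearIndependent (RatFunc F) fun j => polyVec fun p => Polynomial.C (u j p))
    (hu₂ : Submodule.span (RatFunc F)
        (Set.range fun j => polyVec fun p => Polynomial.C (u j p)) =
      Nr (pencil Xc Yc) ⊓ LinearMap.ker (Matrix.mulVecLin (vproj w)))
    {b : ι → (Fin k × Fin n → F[X])} (hb : IsMinimalBasis (Nr (pencil Xc Yc)) b)
    {d : ℕ} {y : Fin d → (Fin n → F[X])} (hy : IsPolyBasis (Nr P) y) :
    ∑ i, polyVecDeg (b i) ≤ ∑ i, polyVecDeg (y i) := by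
  have hyP : ∀ i, P *ᵥ y i = 0 := by
    intro i
    rw [← polyVec_mem_Nr_iff, ← hy.2]
    exact Submodule.subset_span (Set.mem_range_self i)
  choose z hz0 hzd hzy using fun i => exists_lift hk hL hZ (hyP i)
  have hcomp : (Matrix.mulVecLin (vproj w)) ∘ (fun i => polyVec (z i)) =
      fun i => polyVec (y i) := by
    ext1 i
    rw [Function.comp_apply, vproj_mulVecLin_polyVec, hzy]
  have hbasis : IsPolyBasis (Nr (pencil Xc Yc))
      (Fin.append z fun j => fun p => Polynomial.C (u j p)) := by
    rw [isPolyBasis_append_iff]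
    have hzV : ∀ i, polyVec (z i) ∈ Nr (pencil Xc Yc) := fun i => polyVec_mem_Nr_iff.2 (hz0 i)
    refine linearIndependent_and_span_sumElim (f := Matrix.mulVecLin (vproj w))
      (map_vproj_Nr_le hL) hzV ?_ ?_ hu₁ hu₂
    · rw [hcomp]
      exact hy.1
    · rw [hcomp]
      exact hy.2
  refine (hb.2 _ _ hbasis).trans ?_
  have hu0 : ∀ j, polyVecDeg (fun p => Polynomial.C (u j p)) = 0 := fun j =>
    Nat.le_zero.1 (polyVecDeg_le fun p => (natDegree_C _).le)
  simp only [Fin.sum_univ_add, Fin.append_left, Fin.append_right, hu0, Finset.sum_const_zero,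
    add_zero]
  exact Finset.sum_le_sum fun i _ => hzd i


/-- For `m ≤ n`, `nrank P = r`, `c = (k−1)(n−m)` and `L ∈ 𝕃₂(P)` of full
`Z`-rank with nonzero left ansatz vector `w`: if
`β = {x₁(λ), …, x_{n−r}(λ), u_{n−r+1}, …, u_{n−r+c}}` is a minimal basis of `N_r(L)` in
which the constant vectors `u_j` form a basis of the kernel of `𝓛_w`, then
`{𝓛_w(x₁(λ)), …, 𝓛_w(x_{n−r}(λ))}` is a minimal basis of `N_r(P)`; moreover if
`δ₁ ≥ … ≥ δ_{n−r} ≥ 0 = ⋯ = 0` (with `c` trailing zeros) are the right minimal indices of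
`L`, then `δ₁ ≥ … ≥ δ_{n−r}` are the right minimal indices of `P`. -/
theorem statement_12 {F : Type*} [RCLike F] {k m n : ℕ} (hk : 0 < k) (hmn : m ≤ n)
    (r : ℕ) (A : Fin (k + 1) → Matrix (Fin m) (Fin n) F)
    (hr : nrank (matPoly A) = r)
    (Xc Yc : Matrix (Fin k × Fin m) (Fin k × Fin n) F)
    (w : Fin k → F) (hw : w ≠ 0)
    (hL : LeftAnsatz (matPoly A) (pencil Xc Yc) w)
    (hZ : FullZrank2 Yc w)
    (x : Fin (n - r) → (Fin k × Fin n → F[X]))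
    (u : Fin ((k - 1) * (n - m)) → (Fin k × Fin n → F))
    (hβ : IsMinimalBasis (Nr (pencil Xc Yc))
      (Fin.append x fun j => fun p => Polynomial.C (u j p)))
    (hu₁ : LinearIndependent (RatFunc F) fun j => polyVec fun p => Polynomial.C (u j p))
    (hu₂ : Submodule.span (RatFunc F)
        (Set.range fun j => polyVec fun p => Polynomial.C (u j p)) =
      Nr (pencil Xc Yc) ⊓ LinearMap.ker (Matrix.mulVecLin (vproj w))) :
    IsMinimalBasis (Nr (matPoly A)) (fun i => LvPoly w (x i)) ∧
    (∀ δ : Fin (n - r) → ℕ, Antitone δ →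
      HasMinIndices (Nr (pencil Xc Yc))
          (Fin.append δ fun _ : Fin ((k - 1) * (n - m)) => 0) →
        HasMinIndices (Nr (matPoly A)) δ) := by
  set V := Nr (pencil Xc Yc)
  set f := Matrix.mulVecLin (vproj (m := n) w) with hf
  have hfin : Module.finrank (RatFunc F) (Nr (matPoly A)) = n - r := by
    rw [finrank_Nr, hr, Fintype.card_fin]
  have horder : ∀ {d d' : ℕ} {b : Fin d' → (Fin k × Fin n → F[X])} {y : Fin d → (Fin n → F[X])},
      IsMinimalBasis V b → IsPolyBasis (Nr (matPoly A)) y →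
        ∑ i, polyVecDeg (b i) ≤ ∑ i, polyVecDeg (y i) :=
    fun hb hy => order_le_of_isPolyBasis hk hL hZ hu₁ hu₂ hb hy
  obtain ⟨hxli, hxsp⟩ : LinearIndependent (RatFunc F) (fun i => polyVec (LvPoly w (x i))) ∧
      Submodule.span (RatFunc F) (Set.range fun i => polyVec (LvPoly w (x i))) = V.map f := by
    obtain ⟨h1, h2⟩ := isPolyBasis_append_iff.1 hβ.1
    simpa only [Function.comp_def, hf, vproj_mulVecLin_polyVec] using
      linearIndependent_and_span_map h1 h2 hu₂
  have hmap : V.map f = Nr (matPoly A) := by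
    refine Submodule.eq_of_le_of_finrank_eq (map_vproj_Nr_le hL) ?_
    rw [hfin, ← hxsp, finrank_span_eq_card hxli, Fintype.card_fin]
  refine ⟨⟨⟨hxli, hxsp.trans hmap⟩, fun d y hy => ?_⟩, fun δ _ => ?_⟩
  · refine le_trans ?_ (horder hβ hy)
    rw [Fin.sum_univ_add]
    simp only [Fin.append_left]
    exact (Finset.sum_le_sum fun i _ => polyVecDeg_LvPoly_le w (x i)).trans (Nat.le_add_right _ _)
  · rintro ⟨b, hb, hbδ⟩
    obtain ⟨κ, a₀, ha₀, hsp₀, hli₀⟩ :=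
      exists_linearIndependent' (RatFunc F) fun i => polyVec (LvPoly w (b i))
    have hspb : Submodule.span (RatFunc F) (Set.range fun i => polyVec (LvPoly w (b i))) =
        Nr (matPoly A) := by
      rw [← hmap, ← hb.1.2, Submodule.map_span, ← Set.range_comp]
      simp only [Function.comp_def, hf, vproj_mulVecLin_polyVec]
    have : Finite κ := Finite.of_injective a₀ ha₀
    have : Fintype κ := Fintype.ofFinite κ
    have hκ : Fintype.card κ = Fintype.card (Fin (n - r)) := by
      rw [← finrank_span_eq_card hli₀, hsp₀, hspb, hfin, Fintype.card_fin]
    let e : Fin (n - r) ≃ κ := (Fintype.equivOfCardEq hκ).symm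
    let a : Fin (n - r) ↪ Fin (n - r + (k - 1) * (n - m)) := ⟨a₀ ∘ e, ha₀.comp e.injective⟩
    have hy : IsPolyBasis (Nr (matPoly A)) fun i => LvPoly w (b (a i)) := by
      refine ⟨hli₀.comp e e.injective, ?_⟩
      rw [← hspb, ← hsp₀, ← EquivLike.range_comp _ e]
      rfl
    have hle : ∀ i, polyVecDeg (LvPoly w (b (a i))) ≤ polyVecDeg (b (a i)) :=
      fun i => polyVecDeg_LvPoly_le w _
    have hsplit := Finset.sum_add_sum_compl (Finset.univ.map a) fun i => polyVecDeg (b i)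
    rw [Finset.sum_map] at hsplit
    have hord := horder hb hy
    have hsum := Finset.sum_le_sum fun i (_ : i ∈ Finset.univ) => hle i
    have hdeg : ∀ i, polyVecDeg (LvPoly w (b (a i))) = polyVecDeg (b (a i)) := fun i =>
      (Finset.sum_eq_sum_iff_of_le fun i _ => hle i).1 (by omega) i (Finset.mem_univ i)
    have hzero : ∀ i ∈ (Finset.univ.map a)ᶜ, polyVecDeg (b i) = 0 :=
      Finset.sum_eq_zero_iff.1 (by omega)
    have hcard : (Finset.univ.map a)ᶜ.card = (k - 1) * (n - m) := by
      rw [Finset.card_compl, Finset.card_map]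
      simp
    have hmul : (Finset.univ : Finset (Fin (n - r))).val.map δ =
        (Finset.univ : Finset (Fin (n - r))).val.map fun i => polyVecDeg (b (a i)) := by
      have hsing : ∀ g : Fin (n - r) → ℕ, Finset.univ.val.map g = ∑ i, ({g i} : Multiset ℕ) :=
        fun g => by
          rw [← Multiset.sum_map_singleton (Finset.univ.val.map g), Multiset.map_map]
          rfl
      have hall := Finset.sum_add_sum_compl (Finset.univ.map a)
        fun i => ({polyVecDeg (b i)} : Multiset ℕ)
      have hcompl : ∑ i ∈ (Finset.univ.map a)ᶜ, ({polyVecDeg (b i)} : Multiset ℕ) =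
          ((k - 1) * (n - m)) • {0} := by
        rw [Finset.sum_congr rfl fun i hi => by rw [hzero i hi], Finset.sum_const, hcard]
      rw [Finset.sum_map, hcompl, Fin.sum_univ_add] at hall
      simp only [hbδ (Fin.castAdd _ _), hbδ (Fin.natAdd _ _), Fin.append_left, Fin.append_right,
        Finset.sum_const, Finset.card_univ, Fintype.card_fin] at hall
      rw [hsing, hsing]
      exact (add_right_cancel hall).symm
    obtain ⟨σ, hσ⟩ := exists_equiv_of_map_univ_eq hmul
    refine ⟨fun i => LvPoly w (b (a (σ i))), ⟨⟨hy.1.comp σ σ.injective, ?_⟩, fun d y' hy' => ?_⟩,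
      fun i => (hdeg _).trans (hσ i)⟩
    · exact (congrArg (Submodule.span (RatFunc F)) (EquivLike.range_comp
        (fun i => polyVec (LvPoly w (b (a i)))) σ)).trans hy.2
    · refine le_trans ?_ (horder hb hy')
      rw [Equiv.sum_comp σ fun i => polyVecDeg (LvPoly w (b (a i)))]
      omega
end GLin
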